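/- Let L : ℝ² → [0, ∞) be integrable with (1/h²) ∫_{ℝ²} L(p) dp = 1 and ∫_{ℝ²} v_x(p) L(p) dp = 0. Let θ : [0, ∞) × ℝ² → ℝ satisfy the Milne equation v_x(p) ∂_ξ θ(ξ, p) = L(p) ⟨θ(ξ, ·)⟩ − θ(ξ, p) for all ξ ≥ 0 and a.e. p ∈ ℝ² \ {0}, with the same integrability, differentiability and local domination hypotheses as before, and suppose there exists n^∞ ∈ ℝ such that ∫_{ℝ²} |v_x(p)| |θ(ξ, p) − n^∞ L(p)| dp → 0 as ξ → +∞. Then the flux vanishes identically: ∫_{ℝ²} v_x(p) θ(ξ, p) dp = 0 for every ξ ≥ 0. -/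

import Mathlib

open MeasureTheory Real Set Filter

noncomputable section

/-- Euclidean norm of `p ∈ ℝ²` (realized as `ℝ × ℝ`). -/
def pnorm (p : ℝ × ℝ) : ℝ := Real.sqrt (p.1 ^ 2 + p.2 ^ 2)

/-- `x`-component of the semiclassical velocity `v(p) = v_F p/|p|`. -/
def vx (vF : ℝ) (p : ℝ × ℝ) : ℝ := vF * p.1 / pnorm p

/-- Fermi integral of order `k`. -/
def fermiInt (k z : ℝ) : ℝ :=
  (1 / Real.Gamma k) * ∫ t in Set.Ioi (0 : ℝ), t ^ (k - 1) / (Real.exp (t - z) + 1)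

/-- The constant `n₀ = 2π/(β h v_F)²`. -/
def n0 (β vF h : ℝ) : ℝ := 2 * Real.pi / (β * h * vF) ^ 2

/-- Fermi–Dirac distribution with chemical potential `A`. -/
def FD (β vF A : ℝ) (p : ℝ × ℝ) : ℝ := 1 / (Real.exp (β * (vF * pnorm p - A)) + 1)

/-- Linearized Fermi–Dirac distribution. -/
def LFD (β vF h A : ℝ) (p : ℝ × ℝ) : ℝ :=
  (FD β vF A p) ^ 2 * Real.exp (β * (vF * pnorm p - A)) / (n0 β vF h * fermiInt 1 (β * A))

/-- A Carathéodory function on the half-line (measurable in the parameter, continuous in the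
half-line variable) is jointly almost everywhere strongly measurable. -/
theorem aestronglyMeasurable_uncurry_of_continuousOn_Ici {α : Type*} [MeasurableSpace α]
    {μ : Measure α} [SFinite μ] {f : ℝ → α → ℝ}
    (hf : ∀ t ∈ Ici (0 : ℝ), AEMeasurable (f t) μ)
    (hc : ∀ᵐ x ∂μ, ContinuousOn (fun t => f t x) (Ici 0)) :
    AEStronglyMeasurable (fun z : ℝ × α => f z.1 z.2) ((volume.restrict (Ici 0)).prod μ) := by
  have hpos : ∀ n k : ℕ, (k : ℝ) / (n + 1) ∈ Ici (0 : ℝ) := fun n k => by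
    simp only [mem_Ici]; positivity
  choose m hmm hme using fun n k => hf _ (hpos n k)
  have hF : ∀ n : ℕ, Measurable fun z : ℝ × α => m n ⌊z.1 * ((n : ℝ) + 1)⌋₊ z.2 := fun n => by
    have h₁ : Measurable (fun q : ℕ × α => m n q.1 q.2) :=
      measurable_from_prod_countable_right fun k => hmm n k
    have h₂ : Measurable (fun z : ℝ × α => (⌊z.1 * ((n : ℝ) + 1)⌋₊, z.2)) :=
      (Nat.measurable_floor.comp (measurable_fst.mul_const _)).prodMk measurable_snd
    exact h₁.comp h₂
  refine aestronglyMeasurable_of_tendsto_ae atTop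
    (fun n => (hF n).aestronglyMeasurable) ?_
  have hm : ∀ᵐ x ∂μ, ∀ n k : ℕ, f ((k : ℝ) / (n + 1)) x = m n k x :=
    ae_all_iff.2 fun n => ae_all_iff.2 fun k => hme n k
  have h₁ : ∀ᵐ z ∂((volume.restrict (Ici (0 : ℝ))).prod μ), z.1 ∈ Ici (0 : ℝ) :=
    Measure.quasiMeasurePreserving_fst.ae (ae_restrict_mem measurableSet_Ici)
  filter_upwards [h₁, Measure.quasiMeasurePreserving_snd.ae hm,
    Measure.quasiMeasurePreserving_snd.ae hc] with z hz hzm hzc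
  have hlim : Tendsto (fun n : ℕ => (⌊z.1 * ((n : ℝ) + 1)⌋₊ : ℝ) / (n + 1)) atTop
      (nhds z.1) :=
    (tendsto_nat_floor_mul_div_atTop (R := ℝ) hz).comp
      (tendsto_atTop_add_const_right _ 1 tendsto_natCast_atTop_atTop)
  have hlim' : Tendsto (fun n : ℕ => f ((⌊z.1 * ((n : ℝ) + 1)⌋₊ : ℝ) / (n + 1)) z.2) atTop
      (nhds (f z.1 z.2)) := (hzc z.1 hz).tendsto.comp
    (tendsto_nhdsWithin_iff.2 ⟨hlim, Eventually.of_forall fun n => hpos n _⟩)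
  exact hlim'.congr fun n => hzm n _

/-- The partial derivative of a family differentiable along the half-line is jointly almost
everywhere strongly measurable. -/
theorem aestronglyMeasurable_uncurry_of_hasDerivAt {α : Type*} [MeasurableSpace α]
    {μ : Measure α} [SFinite μ] {f f' : ℝ → α → ℝ}
    (hf : ∀ t ∈ Ici (0 : ℝ), AEMeasurable (f t) μ)
    (hd : ∀ᵐ x ∂μ, ∀ t ∈ Ici (0 : ℝ), HasDerivAt (fun s => f s x) (f' t x) t) :
    AEStronglyMeasurable (fun z : ℝ × α => f' z.1 z.2) ((volume.restrict (Ici 0)).prod μ) := by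
  have hshift : ∀ c : ℝ, 0 ≤ c → AEStronglyMeasurable (fun z : ℝ × α => f (z.1 + c) z.2)
      ((volume.restrict (Ici 0)).prod μ) := fun c hc => by
    refine aestronglyMeasurable_uncurry_of_continuousOn_Ici (f := fun t => f (t + c))
      (fun t ht => hf _ (add_nonneg ht hc)) ?_
    filter_upwards [hd] with x hx t ht
    exact ((hx (t + c) (add_nonneg ht hc)).continuousAt.comp
      (f := fun s => s + c) (by fun_prop)).continuousWithinAt
  have hstep : ∀ n : ℕ, (0 : ℝ) < 1 / ((n : ℝ) + 1) := fun n => by positivity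
  refine aestronglyMeasurable_of_tendsto_ae atTop (f := fun (n : ℕ) (z : ℝ × α) =>
    (1 / ((n : ℝ) + 1))⁻¹ • (f (z.1 + 1 / ((n : ℝ) + 1)) z.2 - f (z.1 + 0) z.2))
    (fun n => ((hshift _ (hstep n).le).sub (hshift 0 le_rfl)).fun_const_smul _) ?_
  have h₁ : ∀ᵐ z ∂((volume.restrict (Ici (0 : ℝ))).prod μ), z.1 ∈ Ici (0 : ℝ) :=
    Measure.quasiMeasurePreserving_fst.ae (ae_restrict_mem measurableSet_Ici)
  filter_upwards [h₁, Measure.quasiMeasurePreserving_snd.ae hd] with z hz hzd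
  have hstep' : Tendsto (fun n : ℕ => 1 / ((n : ℝ) + 1)) atTop (nhdsWithin 0 {0}ᶜ) :=
    tendsto_nhdsWithin_iff.2 ⟨tendsto_one_div_add_atTop_nhds_zero_nat,
      Eventually.of_forall fun n => (hstep n).ne'⟩
  simpa [Function.comp_def] using (hzd z.1 hz).tendsto_slope_zero.comp hstep'

/-- If a dominated family is differentiable along the half-line and the derivative tested against
a bounded weight has zero integral at every point, then the weighted integral of the family is
constant. -/
theorem integral_mul_eq_of_integral_mul_deriv_eq_zero {α : Type*} [MeasurableSpace α]
    {μ : Measure α} [SFinite μ] {f f' : ℝ → α → ℝ} {w g : α → ℝ} {C b : ℝ}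
    (hw : Measurable w) (hwC : ∀ x, |w x| ≤ C) (hb : 0 ≤ b)
    (hf : ∀ t ∈ Ici (0 : ℝ), Integrable (f t) μ)
    (hd : ∀ᵐ x ∂μ, ∀ t ∈ Ici (0 : ℝ), HasDerivAt (fun s => f s x) (f' t x) t)
    (hg : Integrable g μ) (hf'g : ∀ t ∈ Icc 0 b, ∀ᵐ x ∂μ, |f' t x| ≤ g x)
    (hzero : ∀ t ∈ Ici (0 : ℝ), ∫ x, w x * f' t x ∂μ = 0) :
    ∫ x, w x * f b x ∂μ = ∫ x, w x * f 0 x ∂μ := by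
  have hIoc : ∀ᵐ t ∂(volume.restrict (Ioc 0 b)), t ∈ Ioc 0 b := ae_restrict_mem measurableSet_Ioc
  have hmeas : AEStronglyMeasurable (fun z : ℝ × α => f' z.1 z.2)
      ((volume.restrict (Ioc 0 b)).prod μ) :=
    (aestronglyMeasurable_uncurry_of_hasDerivAt (fun t ht => (hf t ht).aemeasurable) hd).mono_ac
      ((Measure.absolutelyContinuous_of_le (Measure.restrict_mono
        (Ioc_subset_Icc_self.trans Icc_subset_Ici_self) le_rfl)).prod .rfl)
  have hint : Integrable (fun z : ℝ × α => f' z.1 z.2) ((volume.restrict (Ioc 0 b)).prod μ) := by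
    refine (integrable_prod_iff hmeas).2 ⟨?_, ?_⟩
    · filter_upwards [hIoc, hmeas.prodMk_left] with t ht hmt
      exact hg.mono' hmt (hf'g t (Ioc_subset_Icc_self ht))
    · refine (integrable_const (∫ x, g x ∂μ)).mono' hmeas.norm.integral_prod_right' ?_
      filter_upwards [hIoc] with t ht
      rw [Real.norm_of_nonneg (integral_nonneg fun x => norm_nonneg _)]
      exact integral_mono_of_nonneg (ae_of_all _ fun x => norm_nonneg _) hg
        (hf'g t (Ioc_subset_Icc_self ht))
  have hwint : Integrable (fun z : ℝ × α => w z.2 * f' z.1 z.2)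
      ((volume.restrict (Ioc 0 b)).prod μ) :=
    hint.bdd_mul (hw.comp measurable_snd).aestronglyMeasurable
      (ae_of_all _ fun z => hwC z.2)
  have hwf : ∀ t ∈ Ici (0 : ℝ), Integrable (fun x => w x * f t x) μ := fun t ht =>
    (hf t ht).bdd_mul hw.aestronglyMeasurable (ae_of_all _ hwC)
  rw [← sub_eq_zero, ← integral_sub (hwf b hb) (hwf 0 self_mem_Ici)]
  calc ∫ x, (w x * f b x - w x * f 0 x) ∂μ
      = ∫ x, (∫ t in Ioc 0 b, w x * f' t x) ∂μ := by
        refine integral_congr_ae ?_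
        filter_upwards [hd, hint.prod_left_ae] with x hx hxi
        have hftc := intervalIntegral.integral_eq_sub_of_hasDerivAt (a := 0) (b := b)
          (fun t ht => hx t (by rw [uIcc_of_le hb] at ht; exact ht.1))
          ((intervalIntegrable_iff_integrableOn_Ioc_of_le hb).2 hxi)
        rw [intervalIntegral.integral_of_le hb] at hftc
        rw [integral_const_mul, hftc]
        ring
    _ = ∫ t in Ioc 0 b, ∫ x, w x * f' t x ∂μ := (integral_integral_swap hwint).symm
    _ = 0 := by
        rw [setIntegral_congr_fun measurableSet_Ioc fun t ht => hzero t ht.1.le]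
        simp

theorem measurable_vx (vF : ℝ) : Measurable (vx vF) := by
  unfold vx pnorm
  fun_prop

theorem abs_vx_le {vF : ℝ} (hvF : 0 ≤ vF) (p : ℝ × ℝ) : |vx vF p| ≤ vF := by
  have hp : |p.1| ≤ pnorm p := Real.abs_le_sqrt (by nlinarith [sq_nonneg p.2])
  have hp0 : 0 ≤ pnorm p := Real.sqrt_nonneg _
  rw [vx, abs_div, abs_mul, abs_of_nonneg hvF, abs_of_nonneg hp0]
  exact div_le_of_le_mul₀ hp0 hvF (mul_le_mul_of_nonneg_left hp hvF)

/-- On the half-line `[0,∞)`, if the solution of the Milne equation relaxes to `n^∞ L` in the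
weighted `L¹` sense, then its flux vanishes identically. -/
theorem stmt17 (vF h : ℝ) (hvF : 0 < vF) (hh : 0 < h)
    (L : ℝ × ℝ → ℝ) (hL0 : ∀ p, 0 ≤ L p) (hLint : Integrable L)
    (hLnorm : (1 / h ^ 2) * ∫ p : ℝ × ℝ, L p = 1)
    (hLvx : ∫ p : ℝ × ℝ, vx vF p * L p = 0)
    (θ Dθ : ℝ → ℝ × ℝ → ℝ)
    (hθint : ∀ ξ ∈ Set.Ici (0 : ℝ), Integrable (θ ξ))
    (hderiv : ∀ᵐ p : ℝ × ℝ, ∀ ξ ∈ Set.Ici (0 : ℝ), HasDerivAt (fun ζ => θ ζ p) (Dθ ξ p) ξ)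
    (hdom : ∀ a b : ℝ, Set.Icc a b ⊆ Set.Ici (0 : ℝ) → ∃ g : ℝ × ℝ → ℝ, Integrable g ∧
      ∀ ξ ∈ Set.Icc a b, ∀ᵐ p : ℝ × ℝ, |θ ξ p| ≤ g p ∧ |Dθ ξ p| ≤ g p)
    (hMilne : ∀ ξ ∈ Set.Ici (0 : ℝ), ∀ᵐ p : ℝ × ℝ, p ≠ 0 →
      vx vF p * Dθ ξ p = L p * ((1 / h ^ 2) * ∫ q : ℝ × ℝ, θ ξ q) - θ ξ p)
    (ninf : ℝ)
    (hrelax : Tendsto (fun ξ => ∫ p : ℝ × ℝ, |vx vF p| * |θ ξ p - ninf * L p|)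
      atTop (nhds 0)) :
    ∀ ξ ∈ Set.Ici (0 : ℝ), ∫ p : ℝ × ℝ, vx vF p * θ ξ p = 0 := by
  have hvm := measurable_vx vF
  have hvb := abs_vx_le hvF.le
  have hzero : ∀ ξ ∈ Ici (0 : ℝ), ∫ p : ℝ × ℝ, vx vF p * Dθ ξ p = 0 := fun ξ hξ => by
    have h₁ : (fun p : ℝ × ℝ => vx vF p * Dθ ξ p) =ᵐ[volume]
        fun p => L p * ((1 / h ^ 2) * ∫ q : ℝ × ℝ, θ ξ q) - θ ξ p := by
      filter_upwards [hMilne ξ hξ, Measure.ae_ne volume (0 : ℝ × ℝ)] with p hp hp0 using hp hp0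
    rw [integral_congr_ae h₁, integral_sub (hLint.mul_const _) (hθint ξ hξ), integral_mul_const]
    linear_combination (∫ q : ℝ × ℝ, θ ξ q) * hLnorm
  have hconst : ∀ b ∈ Ici (0 : ℝ),
      ∫ p : ℝ × ℝ, vx vF p * θ b p = ∫ p : ℝ × ℝ, vx vF p * θ 0 p := fun b hb => by
    obtain ⟨g, hg, hgb⟩ := hdom 0 b Icc_subset_Ici_self
    exact integral_mul_eq_of_integral_mul_deriv_eq_zero hvm hvb hb hθint hderiv hg
      (fun t ht => (hgb t ht).mono fun p hp => hp.2) hzero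
  have hbound : ∀ ξ ∈ Ici (0 : ℝ), |∫ p : ℝ × ℝ, vx vF p * θ 0 p| ≤
      ∫ p : ℝ × ℝ, |vx vF p| * |θ ξ p - ninf * L p| := fun ξ hξ => by
    have hθ : Integrable (fun p => vx vF p * θ ξ p) :=
      (hθint ξ hξ).bdd_mul hvm.aestronglyMeasurable (ae_of_all _ hvb)
    have hL : Integrable (fun p => vx vF p * L p) :=
      hLint.bdd_mul hvm.aestronglyMeasurable (ae_of_all _ hvb)
    have h₁ : ∫ p : ℝ × ℝ, vx vF p * (θ ξ p - ninf * L p) = ∫ p : ℝ × ℝ, vx vF p * θ 0 p := by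
      rw [← hconst ξ hξ, ← sub_zero (∫ p : ℝ × ℝ, vx vF p * θ ξ p), ← mul_zero ninf, ← hLvx,
        ← integral_const_mul, ← integral_sub hθ (hL.const_mul _)]
      exact integral_congr_ae (ae_of_all _ fun p => by ring)
    rw [← h₁]
    simpa only [abs_mul] using
      abs_integral_le_integral_abs (f := fun p : ℝ × ℝ => vx vF p * (θ ξ p - ninf * L p))
  have hflux : |∫ p : ℝ × ℝ, vx vF p * θ 0 p| ≤ 0 :=
    ge_of_tendsto hrelax ((eventually_ge_atTop 0).mono hbound)
  exact fun ξ hξ => (hconst ξ hξ).trans (abs_nonpos_iff.1 hflux)
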